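/- Incremental cover construction. Let V_{M'} ⪯ V_M be BPE vocabularies, let e'' be a valid encoding over V_{M'}, let t' ∈ V_{M'} be a token such that e' = e'' · t' is also a valid encoding over V_{M'}. Then cover_{M'→M}(e') is the disjoint union of (i) the set of all c ∈ cover_{M'→M}(e'') such that decode_{M→M'}(c) has e' as a prefix, and (ii) the set of all encodings of the form encode_{M'→M}(e'') · t with t ∈ V_M such that decode_{M→M'}([t]) begins with t' and encode_{M'→M}(e'') · t is a prefix of encode(x; M) for some byte sequence x terminating with EOS. -/

import Mathlib

open scoped ENNReal

/-- A BPE vocabulary with `M` merge rules over alphabet `α` with end-of-string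
symbol `eos`.  The `i`-th merged token (0-based) is `left i ++ right i`, where each
of `left i`, `right i` is either a single non-`eos` alphabet symbol or an earlier
merged token.  Tokens of the vocabulary are pairwise distinct. -/
structure BPE (α : Type*) (eos : α) (M : ℕ) where
  left : ℕ → List α
  right : ℕ → List α
  left_ok : ∀ i < M, (∃ a : α, a ≠ eos ∧ left i = [a]) ∨ ∃ j < i, left i = left j ++ right j
  right_ok : ∀ i < M, (∃ a : α, a ≠ eos ∧ right i = [a]) ∨ ∃ j < i, right i = left j ++ right j
  distinct : ∀ i < M, ∀ j < M, left i ++ right i = left j ++ right j → i = j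

variable {α : Type*} [DecidableEq α] {eos : α} {M : ℕ}

/-- One merge pass: scan left to right, replacing each leftmost non-overlapping
adjacent pair `(l, r)` by the merged token `l ++ r`. -/
def mergeStep (l r : List α) : List (List α) → List (List α)
  | [] => []
  | [x] => [x]
  | x :: y :: rest =>
      if x = l ∧ y = r then (l ++ r) :: mergeStep l r rest
      else x :: mergeStep l r (y :: rest)

/-- One demerge pass: replace every occurrence of the token `l ++ r` by the pair `(l, r)`. -/
def demergeStep (l r : List α) (e : List (List α)) : List (List α) :=
  (e.map fun t => if t = l ++ r then [l, r] else [t]).flatten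

/-- `merge_{i+1}` (0-based index `i`). -/
def BPE.mergeAt (B : BPE α eos M) (i : ℕ) (e : List (List α)) : List (List α) :=
  mergeStep (B.left i) (B.right i) e

/-- `demerge_{i+1}` (0-based index `i`). -/
def BPE.demergeAt (B : BPE α eos M) (i : ℕ) (e : List (List α)) : List (List α) :=
  demergeStep (B.left i) (B.right i) e

/-- `B.encodeRel K n e` applies the merges with 0-based indices `K, K+1, …, K+n-1`
in order; this is the relative encoding `encode_{K → K+n}`. -/
def BPE.encodeRel (B : BPE α eos M) (K : ℕ) : ℕ → List (List α) → List (List α)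
  | 0, e => e
  | n + 1, e => B.mergeAt (K + n) (B.encodeRel K n e)

/-- `B.decodeRel K n e` applies the demerges with 0-based indices `K+n-1, …, K+1, K`
in order; this is the relative decoding `decode_{K+n → K}`. -/
def BPE.decodeRel (B : BPE α eos M) (K : ℕ) : ℕ → List (List α) → List (List α)
  | 0, e => e
  | n + 1, e => B.decodeRel K n (B.demergeAt (K + n) e)

/-- The canonical encoding `encode(s; N)` of a byte string `s` with the first `N` merges. -/
def BPE.encode (B : BPE α eos M) (N : ℕ) (s : List α) : List (List α) :=
  B.encodeRel 0 N (s.map fun a => [a])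

/-- `decode`: concatenate the byte strings of the tokens. -/
def decodeBytes (e : List (List α)) : List α := e.flatten

/-- An encoding over `V_N` is valid (canonical) if re-encoding its decoded string gives it back. -/
def BPE.Valid (B : BPE α eos M) (N : ℕ) (e : List (List α)) : Prop :=
  B.encode N (decodeBytes e) = e

/-- `t` is a token of the truncated vocabulary `V_N` (alphabet symbols and the first `N` merges). -/
def BPE.IsTok (B : BPE α eos M) (N : ℕ) (t : List α) : Prop :=
  (∃ a : α, t = [a]) ∨ ∃ i < N, t = B.left i ++ B.right i

/-- `e` is a token sequence over the truncated vocabulary `V_N`. -/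
def BPE.IsEnc (B : BPE α eos M) (N : ℕ) (e : List (List α)) : Prop :=
  ∀ t ∈ e, B.IsTok N t

/-- `e` (over `V_M`) is a relative cover encoding of `e'` (over `V_{M'}`):
(1) `e` is a prefix of the canonical `V_M`-encoding of some byte sequence terminating
with `eos`, and (2) writing `e = e₀ ++ [t]`, for some index `k < |e'|` the relative
decoding of `e₀` equals the first `k` tokens of `e'` and the remaining tokens
`e'.drop k` form a prefix of the relative decoding of the last token `t`. -/
def BPE.IsCover (B : BPE α eos M) (M' : ℕ) (e' e : List (List α)) : Prop :=
  (∃ x : List α, x.getLast? = some eos ∧ e <+: B.encode M x) ∧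
  ∃ (e₀ : List (List α)) (t : List α), e = e₀ ++ [t] ∧
    ∃ k < e'.length,
      B.decodeRel M' (M - M') e₀ = e'.take k ∧
      e'.drop k <+: B.decodeRel M' (M - M') [t]

/-- The set `cover_{M'→M}(e')` of all relative cover encodings of `e'`. -/
def BPE.cover (B : BPE α eos M) (M' : ℕ) (e' : List (List α)) : Set (List (List α)) :=
  {e | B.IsCover M' e' e}

/-- `P_μ(e; N)`: the probability, under the language model `μ` on byte sequences
terminating with `eos`, that the canonical `V_N`-encoding begins with `e`. -/
noncomputable def BPE.Pr (B : BPE α eos M) (N : ℕ)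
    (μ : PMF {x : List α // x.getLast? = some eos}) (e : List (List α)) : ℝ≥0∞ :=
  μ.toOuterMeasure {x | e <+: B.encode N x.val}


section Merge

variable {l r : List α}

@[simp]
theorem demergeStep_nil : demergeStep l r [] = [] := rfl

theorem demergeStep_cons (t : List α) (e : List (List α)) :
    demergeStep l r (t :: e) = (if t = l ++ r then [l, r] else [t]) ++ demergeStep l r e := by
  simp [demergeStep]

theorem demergeStep_append (e f : List (List α)) :
    demergeStep l r (e ++ f) = demergeStep l r e ++ demergeStep l r f := by
  simp [demergeStep]

theorem mem_mergeStep {t : List α} {e : List (List α)} (h : t ∈ mergeStep l r e) :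
    t ∈ e ∨ t = l ++ r := by
  fun_induction mergeStep l r e <;> grind

theorem demergeStep_mergeStep {e : List (List α)} (h : l ++ r ∉ e) :
    demergeStep l r (mergeStep l r e) = e := by
  fun_induction mergeStep l r e <;> grind [demergeStep_cons, demergeStep_nil]

/-- A prefix of a merged sequence is recovered by demerging it and merging it again. -/
theorem mergeStep_demergeStep_of_prefix {e g : List (List α)} (hg : l ++ r ∉ g)
    (he : e <+: mergeStep l r g) : mergeStep l r (demergeStep l r e) = e := by
  fun_induction mergeStep l r g generalizing e with
  | case1 => simp_all [mergeStep]
  | case2 x =>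
    rcases List.prefix_cons_iff.1 he with rfl | ⟨e₁, rfl, h₁⟩
    · simp [mergeStep]
    · obtain rfl := List.prefix_nil.1 h₁
      have : x ≠ l ++ r := by grind
      simp [demergeStep_cons, this, mergeStep]
  | case3 x y rest hxy ih =>
    rcases List.prefix_cons_iff.1 he with rfl | ⟨e₁, rfl, h₁⟩
    · simp [mergeStep]
    · simp [demergeStep_cons, mergeStep, ih (by grind) h₁]
  | case4 x y rest hxy ih =>
    rcases List.prefix_cons_iff.1 he with rfl | ⟨e₁, rfl, h₁⟩
    · simp [mergeStep]
    · have hx : x ≠ l ++ r := by grind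
      have hy : l ++ r ∉ y :: rest := by grind
      have hpre : demergeStep l r e₁ <+: y :: rest := by
        obtain ⟨s, hs⟩ := h₁
        rw [← demergeStep_mergeStep hy, ← hs, demergeStep_append]
        exact List.prefix_append _ _
      have ih₁ := ih hy h₁
      rw [demergeStep_cons, if_neg hx, List.singleton_append]
      rcases List.prefix_cons_iff.1 hpre with h₂ | ⟨e₂, h₂, -⟩
      · rw [h₂] at ih₁ ⊢
        simp_all [mergeStep]
      · rw [h₂] at ih₁ ⊢
        rw [mergeStep, if_neg hxy, ih₁]

end Merge

namespace BPE

variable {α : Type*} {eos : α} {M : ℕ} (B : BPE α eos M)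

theorem left_append_right_ne_nil {i : ℕ} (hi : i < M) : B.left i ++ B.right i ≠ [] := by
  induction i using Nat.strong_induction_on with
  | _ i ih =>
    rcases B.left_ok i hi with ⟨a, -, h⟩ | ⟨j, hj, h⟩
    · simp [h]
    · rw [h]
      exact List.append_ne_nil_of_left_ne_nil (ih j hj (hj.trans hi)) _

theorem left_ne_nil {i : ℕ} (hi : i < M) : B.left i ≠ [] := by
  rcases B.left_ok i hi with ⟨a, -, h⟩ | ⟨j, hj, h⟩
  · simp [h]
  · exact h ▸ B.left_append_right_ne_nil (hj.trans hi)

theorem right_ne_nil {i : ℕ} (hi : i < M) : B.right i ≠ [] := by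
  rcases B.right_ok i hi with ⟨a, -, h⟩ | ⟨j, hj, h⟩
  · simp [h]
  · exact h ▸ B.left_append_right_ne_nil (hj.trans hi)

variable {B}

theorem IsEnc.left_append_right_notMem {N : ℕ} {e : List (List α)} (he : B.IsEnc N e)
    (hN : N < M) : B.left N ++ B.right N ∉ e := by
  intro hmem
  rcases he _ hmem with ⟨a, ha⟩ | ⟨i, hi, h⟩
  · have hl := List.length_pos_of_ne_nil (B.left_ne_nil hN)
    have hr := List.length_pos_of_ne_nil (B.right_ne_nil hN)
    have := congrArg List.length ha
    simp at this
    omega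
  · have := B.distinct N hN i (hi.trans hN) h
    omega

variable [DecidableEq α]

theorem IsEnc.mergeAt {N : ℕ} {e : List (List α)} (he : B.IsEnc N e) :
    B.IsEnc (N + 1) (B.mergeAt N e) := by
  intro t ht
  rcases mem_mergeStep ht with h | h
  · rcases he t h with h | ⟨i, hi, h⟩
    · exact Or.inl h
    · exact Or.inr ⟨i, by omega, h⟩
  · exact Or.inr ⟨N, by omega, h⟩

theorem IsEnc.encodeRel {K : ℕ} {e : List (List α)} (he : B.IsEnc K e) (n : ℕ) :
    B.IsEnc (K + n) (B.encodeRel K n e) := by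
  induction n with
  | zero => exact he
  | succ n ih => exact ih.mergeAt

theorem isEnc_encode (N : ℕ) (s : List α) : B.IsEnc N (B.encode N s) := by
  have h : B.IsEnc 0 (s.map fun a => [a]) := by
    intro t ht
    obtain ⟨a, -, rfl⟩ := List.mem_map.1 ht
    exact Or.inl ⟨a, rfl⟩
  simpa [BPE.encode] using h.encodeRel N

theorem Valid.isEnc {N : ℕ} {e : List (List α)} (he : B.Valid N e) : B.IsEnc N e := by
  have h := isEnc_encode (B := B) N (decodeBytes e)
  rwa [he] at h

theorem decodeRel_append (K n : ℕ) (e f : List (List α)) :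
    B.decodeRel K n (e ++ f) = B.decodeRel K n e ++ B.decodeRel K n f := by
  induction n generalizing e f with
  | zero => rfl
  | succ n ih => simp only [BPE.decodeRel, BPE.demergeAt, demergeStep_append, ih]

theorem encodeRel_add (K m n : ℕ) (e : List (List α)) :
    B.encodeRel K (m + n) e = B.encodeRel (K + m) n (B.encodeRel K m e) := by
  induction n with
  | zero => rfl
  | succ n ih => rw [← add_assoc, BPE.encodeRel, ih, BPE.encodeRel, add_assoc]

theorem encode_add (K n : ℕ) (s : List α) :
    B.encode (K + n) s = B.encodeRel K n (B.encode K s) := by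
  simp [BPE.encode, encodeRel_add]

theorem IsEnc.decodeRel_encodeRel {K n : ℕ} {e : List (List α)} (he : B.IsEnc K e)
    (hn : K + n ≤ M) : B.decodeRel K n (B.encodeRel K n e) = e := by
  induction n with
  | zero => rfl
  | succ n ih =>
    rw [BPE.encodeRel, BPE.decodeRel, BPE.demergeAt, BPE.mergeAt,
      demergeStep_mergeStep ((he.encodeRel n).left_append_right_notMem (by omega)),
      ih (by omega)]

/-- A prefix of a relative encoding is the relative encoding of its relative decoding. -/
theorem IsEnc.encodeRel_decodeRel_of_prefix {K n : ℕ} {e g : List (List α)} (hg : B.IsEnc K g)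
    (hn : K + n ≤ M) (he : e <+: B.encodeRel K n g) :
    B.encodeRel K n (B.decodeRel K n e) = e := by
  induction n generalizing e with
  | zero => rfl
  | succ n ih =>
    have hfresh := (hg.encodeRel n).left_append_right_notMem (by omega)
    have hpre : B.demergeAt (K + n) e <+: B.encodeRel K n g := by
      obtain ⟨s, hs⟩ := he
      rw [← demergeStep_mergeStep hfresh]
      change _ <+: demergeStep _ _ (B.encodeRel K (n + 1) g)
      rw [← hs, demergeStep_append]
      exact List.prefix_append _ _
    rw [BPE.decodeRel, BPE.encodeRel, ih (by omega) hpre]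
    exact mergeStep_demergeStep_of_prefix hfresh he

end BPE

/-- **Incremental cover construction.** If `e''` and `e' = e'' · t'` are valid encodings
over `V_{M'}` (with `t'` a token of `V_{M'}`), then `cover_{M'→M}(e')` is the disjoint
union of (i) the covers `c` of `e''` whose relative decoding extends `e'`, and (ii) the
encodings `encode_{M'→M}(e'') · t` with `t ∈ V_M` whose relative decoding begins with
`t'` and which are a prefix of the canonical `V_M`-encoding of some byte sequence
terminating with `EOS`. -/
theorem incremental_cover_construction {α : Type*} [DecidableEq α] [Fintype α] {eos : α}
    {M : ℕ} (B : BPE α eos M) (M' : ℕ) (hM : M' ≤ M)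
    (e'' : List (List α)) (t' : List α)
    (he'' : B.Valid M' e'') (ht' : B.IsTok M' t') (he' : B.Valid M' (e'' ++ [t'])) :
    B.cover M' (e'' ++ [t'])
        = {c ∈ B.cover M' e'' | (e'' ++ [t']) <+: B.decodeRel M' (M - M') c}
          ∪ {c | ∃ t : List α, B.IsTok M t ∧
              [t'] <+: B.decodeRel M' (M - M') [t] ∧
              c = B.encodeRel M' (M - M') e'' ++ [t] ∧
              ∃ x : List α, x.getLast? = some eos ∧ c <+: B.encode M x} ∧
    Disjoint
      {c ∈ B.cover M' e'' | (e'' ++ [t']) <+: B.decodeRel M' (M - M') c}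
      {c | ∃ t : List α, B.IsTok M t ∧
          [t'] <+: B.decodeRel M' (M - M') [t] ∧
          c = B.encodeRel M' (M - M') e'' ++ [t] ∧
          ∃ x : List α, x.getLast? = some eos ∧ c <+: B.encode M x} := by
  obtain ⟨n, rfl⟩ := Nat.exists_eq_add_of_le hM
  simp only [Nat.add_sub_cancel_left]
  have hround : B.decodeRel M' n (B.encodeRel M' n e'') = e'' :=
    he''.isEnc.decodeRel_encodeRel le_rfl
  refine ⟨Set.ext fun c => ⟨?_, ?_⟩, ?_⟩
  · rintro ⟨⟨x, hx, hcx⟩, e₀, t, rfl, k, hk, htake, hdrop⟩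
    rw [Nat.add_sub_cancel_left] at htake hdrop
    have hk' : k ≤ e''.length := by simpa [Nat.lt_succ_iff] using hk
    rcases hk'.lt_or_eq with hlt | rfl
    · refine Or.inl ⟨⟨⟨x, hx, hcx⟩, e₀, t, rfl, k, hlt, ?_, ?_⟩, ?_⟩
      · rw [Nat.add_sub_cancel_left, htake, List.take_append_of_le_length hk']
      · rw [Nat.add_sub_cancel_left]
        rw [List.drop_append_of_le_length hk'] at hdrop
        exact (List.prefix_append _ _).trans hdrop
      · rw [BPE.decodeRel_append, htake]
        conv_lhs => rw [← List.take_append_drop k (e'' ++ [t'])]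
        exact (List.prefix_append_right_inj _).2 hdrop
    · rw [List.take_left] at htake
      rw [List.drop_left] at hdrop
      refine Or.inr ⟨t, ?_, hdrop, ?_, x, hx, hcx⟩
      · exact BPE.isEnc_encode _ x t (hcx.subset (by simp))
      · have hpre : e₀ <+: B.encodeRel M' n (B.encode M' x) := by
          rw [← BPE.encode_add]
          exact (List.prefix_append _ _).trans hcx
        rw [← htake, (BPE.isEnc_encode M' x).encodeRel_decodeRel_of_prefix le_rfl hpre]
  · rintro (⟨⟨hx, e₀, t, rfl, k, hk, htake, -⟩, hpre⟩ | ⟨t, -, ht, rfl, hx⟩)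
    · rw [Nat.add_sub_cancel_left] at htake
      have htake' : B.decodeRel M' n e₀ = (e'' ++ [t']).take k := by
        rw [htake, List.take_append_of_le_length hk.le]
      refine ⟨hx, e₀, t, rfl, k, by simp; omega, ?_, ?_⟩
      · rwa [Nat.add_sub_cancel_left]
      · rw [Nat.add_sub_cancel_left]
        rw [BPE.decodeRel_append, htake'] at hpre
        refine (List.prefix_append_right_inj ((e'' ++ [t']).take k)).1 ?_
        rwa [List.take_append_drop]
    · refine ⟨hx, _, t, rfl, e''.length, by simp, ?_, ?_⟩
      · rw [Nat.add_sub_cancel_left, hround, List.take_left]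
      · rwa [Nat.add_sub_cancel_left, List.drop_left]
  · rw [Set.disjoint_left]
    rintro c ⟨⟨-, e₀, t, rfl, k, hk, htake, -⟩, -⟩ ⟨s, -, -, hc, -⟩
    obtain ⟨rfl, -⟩ := List.append_inj' hc rfl
    rw [Nat.add_sub_cancel_left, hround] at htake
    have := congrArg List.length htake
    rw [List.length_take] at this
    omega
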